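/- arXiv:1511.04937 — 3 statements merged into one kernel-verified Lean document; each statement's English description precedes it below -/
import Mathlib

section
/- Let b ≥ 2, n ≥ 1, σ a permutation of {0,…,b−1} and 1 ≤ i < j ≤ n. Then ∑_{N=1}^{b^n} φ_b^σ(N/b^i) · φ_b^σ(N/b^j) = b^{n+2} · (Φ_b^σ)^2. -/
open Finset
open scoped Classical

noncomputable section

namespace SymHamm

/-- The reversal permutation `τ(k) = b−1−k` on `{0,…,b−1}`. -/
def tauP (b : ℕ) : Equiv.Perm (Fin b) := Fin.revPerm

/-- `σ̄ = τ ∘ σ`. -/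
def pbar {b : ℕ} (σ : Equiv.Perm (Fin b)) : Equiv.Perm (Fin b) := σ.trans (tauP b)

/-- Value of a permutation of `Fin b` on a natural number. -/
def permVal {b : ℕ} (σ : Equiv.Perm (Fin b)) (k : ℕ) : ℕ :=
  if h : k < b then (σ ⟨k, h⟩ : ℕ) else 0

/-- Faure's function `φ_{b,h}^σ`, extended with period 1 to all of `ℝ`.
For `x ∈ [(k−1)/b, k/b)` (i.e. `k−1 = ⌊b·{x}⌋`), it equals
`A([0,h/b);k;Z_b^σ) − h·x` if `h ≤ σ(k−1)` and `(b−h)·x − A([h/b,1);k;Z_b^σ)` otherwise,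
where `A` counts the first `k` entries `σ(0)/b,…,σ(k−1)/b` of `Z_b^σ` in the interval. -/
def phi {b : ℕ} (σ : Equiv.Perm (Fin b)) (h : ℕ) (x : ℝ) : ℝ :=
  if h ≤ permVal σ (⌊(b : ℝ) * Int.fract x⌋).toNat then
    (((Finset.range ((⌊(b : ℝ) * Int.fract x⌋).toNat + 1)).filter
        (fun l => permVal σ l < h)).card : ℝ) - (h : ℝ) * Int.fract x
  else
    ((b : ℝ) - (h : ℝ)) * Int.fract x -
      (((Finset.range ((⌊(b : ℝ) * Int.fract x⌋).toNat + 1)).filter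
        (fun l => h ≤ permVal σ l)).card : ℝ)

/-- `φ_b^σ = ∑_{h=0}^{b−1} φ_{b,h}^σ`. -/
def phiS {b : ℕ} (σ : Equiv.Perm (Fin b)) (x : ℝ) : ℝ := ∑ h ∈ range b, phi σ h x

/-- `φ_b^{σ,(2)} = ∑_{h=0}^{b−1} (φ_{b,h}^σ)²`. -/
def phiS2 {b : ℕ} (σ : Equiv.Perm (Fin b)) (x : ℝ) : ℝ := ∑ h ∈ range b, (phi σ h x) ^ 2

/-- `φ̃_b^σ = ∑_{h=0}^{b−1} φ_{b,h}^σ · φ_{b,h}^{σ̄}`. -/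
def phiT {b : ℕ} (σ : Equiv.Perm (Fin b)) (x : ℝ) : ℝ :=
  ∑ h ∈ range b, phi σ h x * phi (pbar σ) h x

/-- `φ̃_{b,1}^σ = ∑_{h=0}^{b−2} φ_{b,h+1}^σ · φ_{b,h}^{σ̄}`. -/
def phiT1 {b : ℕ} (σ : Equiv.Perm (Fin b)) (x : ℝ) : ℝ :=
  ∑ h ∈ range (b - 1), phi σ (h + 1) x * phi (pbar σ) h x

/-- `φ̃_{b,2}^σ = ∑_{h=0}^{b−2} φ_{b,h}^σ · φ_{b,h+1}^{σ̄}`. -/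
def phiT2 {b : ℕ} (σ : Equiv.Perm (Fin b)) (x : ℝ) : ℝ :=
  ∑ h ∈ range (b - 1), phi σ h x * phi (pbar σ) (h + 1) x

/-- `Φ_b^σ = (1/b)·∫_0^1 φ_b^σ`. -/
def PhiS {b : ℕ} (σ : Equiv.Perm (Fin b)) : ℝ := (1 / (b : ℝ)) * ∫ x in (0:ℝ)..1, phiS σ x

/-- `Φ_b^{σ,(2)} = (1/b)·∫_0^1 φ_b^{σ,(2)}`. -/
def PhiS2 {b : ℕ} (σ : Equiv.Perm (Fin b)) : ℝ := (1 / (b : ℝ)) * ∫ x in (0:ℝ)..1, phiS2 σ x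

/-- `Φ̃_b^σ = (1/b)·∫_0^1 φ̃_b^σ`. -/
def PhiT {b : ℕ} (σ : Equiv.Perm (Fin b)) : ℝ := (1 / (b : ℝ)) * ∫ x in (0:ℝ)..1, phiT σ x

/-- `Φ̃_{b,1}^σ = (1/b)·∫_0^1 φ̃_{b,1}^σ`. -/
def PhiT1 {b : ℕ} (σ : Equiv.Perm (Fin b)) : ℝ := (1 / (b : ℝ)) * ∫ x in (0:ℝ)..1, phiT1 σ x

/-- `Φ̃_{b,2}^σ = (1/b)·∫_0^1 φ̃_{b,2}^σ`. -/
def PhiT2 {b : ℕ} (σ : Equiv.Perm (Fin b)) : ℝ := (1 / (b : ℝ)) * ∫ x in (0:ℝ)..1, phiT2 σ x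

/-- `ν_j(N,Σ) = σ_j(N_j)·b^{n−j−1} + … + σ_{n−1}(N_{n−1})`, where `N_i` is the `i`-th
`b`-adic digit of `N`. -/
def nu (b n : ℕ) (S : Fin n → Equiv.Perm (Fin b)) (N j : ℕ) : ℕ :=
  ∑ i : Fin n,
    if j ≤ (i : ℕ) then permVal (S i) ((N / b ^ (i : ℕ)) % b) * b ^ (n - 1 - (i : ℕ)) else 0

/-- `ε_j(λ,N,Σ)`, for `1 ≤ j ≤ n`: it is `0` when `λ = bⁿ` or `N = bⁿ`; it is the last digit
`λ_n = λ % b` when `j = n`; otherwise, with `Λ_{j−1} = λ % b^{n−j+1}` and `ν_j = ν_j(N,Σ)`,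
it is `0` if `Λ_{j−1} ≤ ν_j`, it is `h` if `ν_j + (h−1)b^{n−j} < Λ_{j−1} ≤ ν_j + h·b^{n−j}`
for some `1 ≤ h < b`, and `0` if `ν_j + (b−1)b^{n−j} < Λ_{j−1} < b^{n−j+1}`. -/
def eps (b n : ℕ) (S : Fin n → Equiv.Perm (Fin b)) (lam N j : ℕ) : ℕ :=
  if lam = b ^ n ∨ N = b ^ n then 0
  else if j = n then lam % b
  else if lam % b ^ (n - j + 1) ≤ nu b n S N j then 0
  else ((lam % b ^ (n - j + 1) - nu b n S N j - 1) / b ^ (n - j) + 1) % b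

/-- The point of the digit-scrambled Hammersley point set `R_{b,n}^Σ` with digits `a`:
`(∑_{j=0}^{n−1} σ_j(a_j)/b^{n−j}, ∑_{j=0}^{n−1} a_j/b^{j+1})`. -/
def hammPt (b n : ℕ) (S : Fin n → Equiv.Perm (Fin b)) (a : Fin n → Fin b) : ℝ × ℝ :=
  (∑ j : Fin n, ((S j (a j) : ℕ) : ℝ) / (b : ℝ) ^ (n - (j : ℕ)),
   ∑ j : Fin n, ((a j : ℕ) : ℝ) / (b : ℝ) ^ ((j : ℕ) + 1))

/-- The symmetrized Hammersley point set `R_{b,n}^{Σ,sym} = R_{b,n}^Σ ∪ R_{b,n}^{Σ*}`,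
a family of `2·bⁿ` points. -/
def symFam (b n : ℕ) (S : Fin n → Equiv.Perm (Fin b)) :
    Bool × (Fin n → Fin b) → ℝ × ℝ :=
  fun p => if p.1 then hammPt b n S p.2 else hammPt b n (fun i => pbar (S i)) p.2

/-- Local discrepancy `E(x,y,P) = #{i : P i ∈ [0,x)×[0,y)} − N·x·y` of a finite family of
points, where `N` is the number of points. -/
def localDisc {ι : Type} [Fintype ι] (P : ι → ℝ × ℝ) (x y : ℝ) : ℝ :=
  ((Finset.univ.filter
      (fun i => 0 ≤ (P i).1 ∧ (P i).1 < x ∧ 0 ≤ (P i).2 ∧ (P i).2 < y)).card : ℝ)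
    - (Fintype.card ι : ℝ) * x * y

/-- `L_2` discrepancy `L2(P) = (1/N)·(∫_0^1∫_0^1 E(x,y,P)² dx dy)^{1/2}`. -/
def L2disc {ι : Type} [Fintype ι] (P : ι → ℝ × ℝ) : ℝ :=
  (1 / (Fintype.card ι : ℝ)) *
    Real.sqrt (∫ x in (0:ℝ)..1, ∫ y in (0:ℝ)..1, (localDisc P x y) ^ 2)


/-- The slope of `s ↦ phiS σ ((k + s) / b)` on `[0, 1)`. -/
def phiSlope {b : ℕ} (σ : Equiv.Perm (Fin b)) (k : ℕ) : ℝ := ((b : ℝ) - 1) / 2 - permVal σ k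

/-- The value of `phiS σ` at the node `k / b`. -/
def phiNode {b : ℕ} (σ : Equiv.Perm (Fin b)) (k : ℕ) : ℝ := ∑ l ∈ range k, phiSlope σ l

lemma permVal_lt {b : ℕ} (σ : Equiv.Perm (Fin b)) {k : ℕ} (hk : k < b) : permVal σ k < b := by
  simp [permVal, hk]

lemma sum_range_id_cast (b : ℕ) : ∑ h ∈ range b, (h : ℝ) = b * ((b : ℝ) - 1) / 2 := by
  induction b with
  | zero => simp
  | succ b ih => rw [sum_range_succ, ih]; push_cast; ring

lemma sum_phiSlope {b : ℕ} (σ : Equiv.Perm (Fin b)) : ∑ k ∈ range b, phiSlope σ k = 0 := by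
  have h : ∑ k ∈ range b, (permVal σ k : ℝ) = ∑ k ∈ range b, (k : ℝ) := by
    rw [← Fin.sum_univ_eq_sum_range (fun k => (permVal σ k : ℝ)),
      ← Fin.sum_univ_eq_sum_range (fun k => (k : ℝ)),
      ← Equiv.sum_comp σ (fun k : Fin b => ((k : ℕ) : ℝ))]
    simp [permVal]
  simp only [phiSlope, sum_sub_distrib, h, sum_range_id_cast, sum_const, card_range, nsmul_eq_mul]
  ring

lemma sum_range_ite_lt {b v : ℕ} (hv : v < b) :
    ∑ h ∈ range b, (if v < h then (1 : ℝ) else 0) = b - 1 - v := by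
  rw [sum_boole]
  have : (range b).filter (fun h => v < h) = Ioo v b := by
    ext h; simp [and_comm]
  rw [this, Nat.card_Ioo, Nat.sub_sub, Nat.cast_sub (by omega)]
  push_cast; ring

lemma phi_add_div {b : ℕ} (σ : Equiv.Perm (Fin b)) (h : ℕ) {k : ℕ} (hk : k < b) {s : ℝ}
    (hs : 0 ≤ s) (hs1 : s < 1) :
    phi σ h ((k + s) / b) = (∑ l ∈ range k, if permVal σ l < h then (1 : ℝ) else 0)
      - h * ((k + s) / b) + (if permVal σ k < h then 1 else 0) * s := by
  have hb : (0 : ℝ) < b := by exact_mod_cast (Nat.zero_le k).trans_lt hk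
  have hkb : (k : ℝ) + 1 ≤ b := by exact_mod_cast hk
  have hf : Int.fract (((k : ℝ) + s) / b) = (k + s) / b := by
    rw [Int.fract_eq_self]
    exact ⟨by positivity, by rw [div_lt_one hb]; linarith⟩
  have hfl : ⌊(b : ℝ) * ((k + s) / b)⌋ = k := by
    rw [mul_div_cancel₀ _ hb.ne', Int.floor_eq_iff]
    push_cast
    constructor <;> linarith
  have hcompl : (((range (k + 1)).filter (fun l => h ≤ permVal σ l)).card : ℝ) =
      (k + 1) - ∑ l ∈ range (k + 1), if permVal σ l < h then (1 : ℝ) else 0 := by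
    have := card_filter_add_card_filter_not (s := range (k + 1)) (fun l => permVal σ l < h)
    simp only [not_lt, card_range] at this
    rw [sum_boole, eq_sub_iff_add_eq']
    exact_mod_cast this
  have hmul : (b : ℝ) * ((k + s) / b) = k + s := mul_div_cancel₀ _ hb.ne'
  unfold phi
  rw [hf, hfl, Int.toNat_natCast, hcompl, ← sum_boole, sum_range_succ]
  by_cases hh : h ≤ permVal σ k
  · simp [hh, hh.not_gt]
  · simp only [if_neg hh, if_pos (not_le.mp hh)]
    linear_combination hmul

/-- `phiS σ` interpolates its values at the nodes `k / b` linearly. -/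
lemma phiS_add_div {b : ℕ} (σ : Equiv.Perm (Fin b)) {k : ℕ} (hk : k < b) {s : ℝ}
    (hs : 0 ≤ s) (hs1 : s < 1) :
    phiS σ ((k + s) / b) = phiNode σ k + phiSlope σ k * s := by
  have hb : (b : ℝ) ≠ 0 := by exact_mod_cast ((Nat.zero_le k).trans_lt hk).ne'
  have hsum : ∑ l ∈ range k, ∑ h ∈ range b, (if permVal σ l < h then (1 : ℝ) else 0) =
      ∑ l ∈ range k, ((b : ℝ) - 1 - permVal σ l) :=
    sum_congr rfl fun l hl =>
      sum_range_ite_lt (permVal_lt σ ((mem_range.mp hl).trans hk))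
  have hnode : phiNode σ k = ∑ l ∈ range k, ((b : ℝ) - 1 - permVal σ l) - k * ((b - 1) / 2) := by
    simp only [phiNode, phiSlope, sum_sub_distrib, sum_const, card_range, nsmul_eq_mul]
    ring
  unfold phiS
  rw [sum_congr rfl fun h _ => phi_add_div σ h hk hs hs1, sum_add_distrib, sum_sub_distrib,
    sum_comm, hsum, ← sum_mul, ← sum_mul, sum_range_ite_lt (permVal_lt σ hk),
    sum_range_id_cast, hnode, phiSlope]
  field_simp
  ring

lemma phiS_add_nat {b : ℕ} (σ : Equiv.Perm (Fin b)) (x : ℝ) (m : ℕ) :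
    phiS σ (m + x) = phiS σ x := by
  simp only [phiS, phi, Int.fract_natCast_add]

lemma sum_range_mul_eq {M : Type*} [AddCommMonoid M] (f : ℕ → M) (m n : ℕ) :
    ∑ N ∈ range (m * n), f N = ∑ k ∈ range m, ∑ r ∈ range n, f (k * n + r) := by
  induction m with
  | zero => simp
  | succ m ih => rw [add_one_mul, sum_range_add, ih, sum_range_succ]

lemma integral_phiS {b : ℕ} (hb : 0 < b) (σ : Equiv.Perm (Fin b)) :
    ∫ x in (0 : ℝ)..1, phiS σ x = (∑ k ∈ range b, phiNode σ k) / b := by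
  have hb' : (0 : ℝ) < b := by exact_mod_cast hb
  have hle (k : ℕ) : (k : ℝ) / b ≤ ((k + 1 : ℕ) : ℝ) / b := by gcongr; simp
  have hEq {k : ℕ} (hk : k < b) : Set.EqOn
      (fun x => phiNode σ k + phiSlope σ k * (b * x - k)) (phiS σ)
      (Set.Ioo ((k : ℝ) / b) (((k + 1 : ℕ) : ℝ) / b)) := by
    rintro x ⟨h1, h2⟩
    rw [div_lt_iff₀ hb'] at h1
    rw [lt_div_iff₀ hb'] at h2
    push_cast at h2
    have := phiS_add_div σ hk (s := b * x - k) (by linarith) (by linarith)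
    rw [add_sub_cancel, mul_div_cancel_left₀ _ hb'.ne'] at this
    exact this.symm
  have hint : ∀ k < b, IntervalIntegrable (phiS σ) MeasureTheory.volume
      ((k : ℝ) / b) (((k + 1 : ℕ) : ℝ) / b) := by
    intro k hk
    have hc : IntervalIntegrable (fun x : ℝ => phiNode σ k + phiSlope σ k * (b * x - k))
        MeasureTheory.volume ((k : ℝ) / b) (((k + 1 : ℕ) : ℝ) / b) :=
      Continuous.intervalIntegrable (by fun_prop) _ _
    exact hc.congr_uIoo (Set.uIoo_of_le (hle k) ▸ hEq hk)
  have hval : ∀ k < b, ∫ x in ((k : ℝ) / b)..(((k + 1 : ℕ) : ℝ) / b), phiS σ x =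
      (phiNode σ k + phiSlope σ k / 2) / b := by
    intro k hk
    rw [← intervalIntegral.integral_congr_Ioo_of_le (hle k) (hEq hk),
      intervalIntegral.integral_add (by simp) (Continuous.intervalIntegrable (by fun_prop) _ _),
      intervalIntegral.integral_const_mul,
      intervalIntegral.integral_sub (Continuous.intervalIntegrable (by fun_prop) _ _) (by simp),
      intervalIntegral.integral_const_mul, integral_id]
    simp only [intervalIntegral.integral_const, smul_eq_mul]
    push_cast
    field_simp
    ring
  have htot := intervalIntegral.sum_integral_adjacent_intervals
    (a := fun k : ℕ => (k : ℝ) / b) (f := phiS σ) hint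
  simp only [Nat.cast_zero, zero_div, div_self hb'.ne'] at htot
  rw [← htot, sum_congr rfl fun k hk => hval k (mem_range.mp hk), ← sum_div, sum_add_distrib,
    ← sum_div, sum_phiSlope]
  simp

/-- Averages of `phiS σ` over shifted grids whose mesh refines `1 / b` are independent of the
shift. -/
lemma sum_phiS_grid {b q : ℕ} (hb : 0 < b) (hq : 0 < q) (σ : Equiv.Perm (Fin b)) {y : ℝ}
    (hy : 0 ≤ y) (hy1 : y < 1) :
    ∑ m ∈ range (b * q), phiS σ ((m + y) / (b * q)) =
      b * q * ∫ x in (0 : ℝ)..1, phiS σ x := by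
  have hb' : (b : ℝ) ≠ 0 := by exact_mod_cast hb.ne'
  have hq' : (0 : ℝ) < q := by exact_mod_cast hq
  have hterm : ∀ k ∈ range b, ∑ t ∈ range q, phiS σ (((k * q + t : ℕ) + y) / (b * q)) =
      q * phiNode σ k + phiSlope σ k * ∑ t ∈ range q, ((t + y) / q : ℝ) := by
    intro k hk
    have hconst : (q : ℝ) * phiNode σ k = ∑ t ∈ range q, phiNode σ k := by simp
    rw [mul_sum, hconst, ← sum_add_distrib]
    refine sum_congr rfl fun t ht => ?_
    have ht' : (t : ℝ) + 1 ≤ q := by exact_mod_cast mem_range.mp ht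
    rw [← phiS_add_div σ (mem_range.mp hk) (by positivity)
      (by rw [div_lt_one hq']; linarith)]
    congr 1
    push_cast
    field_simp
    ring
  rw [sum_range_mul_eq, sum_congr rfl hterm, sum_add_distrib, ← mul_sum, ← sum_mul, sum_phiSlope,
    integral_phiS hb]
  field_simp
  ring

lemma sum_phiS_pow {b d : ℕ} (hb : 0 < b) (hd : 0 < d) (σ : Equiv.Perm (Fin b)) {y : ℝ}
    (hy : 0 ≤ y) (hy1 : y < 1) :
    ∑ m ∈ range (b ^ d), phiS σ ((m + y) / (b : ℝ) ^ d) =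
      (b : ℝ) ^ d * ∫ x in (0 : ℝ)..1, phiS σ x := by
  obtain ⟨e, rfl⟩ := Nat.exists_eq_add_of_lt hd
  have := sum_phiS_grid hb (pow_pos hb e) σ hy hy1
  push_cast at this
  simpa only [zero_add, pow_succ'] using this

theorem stmt5 (b : ℕ) (hb : 2 ≤ b) (n : ℕ) (hn : 1 ≤ n) (σ : Equiv.Perm (Fin b))
    (i j : ℕ) (hi : 1 ≤ i) (hij : i < j) (hj : j ≤ n) :
    ∑ N ∈ Finset.Icc 1 (b ^ n),
        phiS σ ((N : ℝ) / (b : ℝ) ^ i) * phiS σ ((N : ℝ) / (b : ℝ) ^ j) =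
      (b : ℝ) ^ (n + 2) * (PhiS σ) ^ 2 := by
  have hb0 : 0 < b := by omega
  have hb' : (0 : ℝ) < b := by exact_mod_cast hb0
  obtain ⟨d, rfl⟩ := Nat.exists_eq_add_of_lt hij
  obtain ⟨e, rfl⟩ := Nat.exists_eq_add_of_le hj
  have hperiod (k m : ℕ) (hk : k ≤ m) : phiS σ ((b : ℝ) ^ m / (b : ℝ) ^ k) = phiS σ 0 := by
    rw [div_eq_mul_inv, ← pow_sub₀ _ hb'.ne' hk]
    simpa using phiS_add_nat σ 0 (b ^ (m - k))
  have hshift (f : ℕ → ℝ) (B : ℕ) (h : f B = f 0) :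
      ∑ N ∈ Icc 1 B, f N = ∑ N ∈ range B, f N := by
    have h1 := sum_range_succ f B
    rw [sum_range_succ'] at h1
    rw [← Ico_add_one_right_eq_Icc, sum_Ico_eq_sum_range]
    simp only [Nat.add_sub_cancel, add_comm 1]
    linarith
  rw [hshift _ _ (by simp only [Nat.cast_pow]; rw [hperiod _ _ (by omega), hperiod _ _ hj]; simp)]
  rw [show b ^ (i + d + 1 + e) = b ^ e * b ^ (d + 1) * b ^ i by ring, sum_range_mul_eq, sum_comm]
  have hinner : ∀ r ∈ range (b ^ i), ∑ m ∈ range (b ^ e * b ^ (d + 1)),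
      phiS σ (((m * b ^ i + r : ℕ) : ℝ) / (b : ℝ) ^ i) *
        phiS σ (((m * b ^ i + r : ℕ) : ℝ) / (b : ℝ) ^ (i + d + 1)) =
      phiS σ ((r + 0) / (b : ℝ) ^ i) *
        ((b : ℝ) ^ e * ((b : ℝ) ^ (d + 1) * ∫ x in (0 : ℝ)..1, phiS σ x)) := by
    intro r hr
    have hr' : (r : ℝ) < (b : ℝ) ^ i := by exact_mod_cast mem_range.mp hr
    have hsum := sum_phiS_pow hb0 d.succ_pos σ (y := r / (b : ℝ) ^ i) (by positivity)
      (by rwa [div_lt_one (by positivity)])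
    have hconst : (b : ℝ) ^ e * ((b : ℝ) ^ (d + 1) * ∫ x in (0 : ℝ)..1, phiS σ x) =
        ∑ u ∈ range (b ^ e), ∑ m ∈ range (b ^ (d + 1)),
          phiS σ ((m + r / (b : ℝ) ^ i) / (b : ℝ) ^ (d + 1)) := by
      rw [sum_const, hsum, card_range, nsmul_eq_mul]
      push_cast
      rfl
    rw [sum_range_mul_eq, hconst, mul_sum]
    refine sum_congr rfl fun u _ => ?_
    rw [mul_sum]
    refine sum_congr rfl fun m _ => ?_
    rw [← phiS_add_nat σ ((r + 0) / (b : ℝ) ^ i) (u * b ^ (d + 1) + m),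
      ← phiS_add_nat σ (_ / (b : ℝ) ^ (d + 1)) u]
    congr 2
    · push_cast
      field_simp
      ring
    · push_cast
      field_simp
      ring
  have hlast := sum_phiS_pow hb0 hi σ le_rfl zero_lt_one
  rw [sum_congr rfl hinner, ← sum_mul, hlast, PhiS]
  field_simp
  ring

end SymHamm
end
end

section
/- Let b ≥ 2, n ≥ 1, σ a permutation of {0,…,b−1} and Σ ∈ {σ,σ̄}^n. For all 1 ≤ N ≤ b^n and 1 ≤ j ≤ n−1: if ν_j(N,Σ) < (b^{n−j}−1)/2 then ∑_{λ=1}^{b^n} φ_{b,ε_j(λ,N,Σ)}^σ(N/b^j)·φ_{b,ε_j(λ,N,Σ*)}^{σ̄}(N/b^j) = b^{n−1}·φ̃_b^σ(N/b^j) + b^{j−1}·(b^{n−j} − 1 − 2ν_j(N,Σ))·(φ̃_{b,1}^σ(N/b^j) − φ̃_b^σ(N/b^j)), and if ν_j(N,Σ) ≥ (b^{n−j}−1)/2 then this sum equals b^{n−1}·φ̃_b^σ(N/b^j) + b^{j−1}·(2ν_j(N,Σ) + 1 − b^{n−j})·(φ̃_{b,2}^σ(N/b^j) − φ̃_b^σ(N/b^j)).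 Moreover, for j = n, ∑_{λ=1}^{b^n} φ_{b,ε_n(λ,N,Σ)}^σ(N/b^n)·φ_{b,ε_n(λ,N,Σ*)}^{σ̄}(N/b^n) = b^{n−1}·φ̃_b^σ(N/b^n). -/
open Finset
open scoped Classical

noncomputable section

namespace SymHamm

theorem sum_range_mul_eq_s7 (K M : ℕ) (G : ℕ → ℝ) :
    ∑ l ∈ range (K * M), G l = ∑ h ∈ range K, ∑ r ∈ range M, G (h * M + r) := by
  induction K with
  | zero => simp
  | succ K ih => rw [Nat.succ_mul, sum_range_add, ih, sum_range_succ]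

theorem sum_Icc_mod (K M : ℕ) (F : ℕ → ℝ) :
    ∑ l ∈ Finset.Icc 1 (K * M), F (l % M) = K * ∑ r ∈ range M, F r := by
  have hshift : ∑ l ∈ Finset.Icc 1 (K * M), F (l % M) = ∑ l ∈ range (K * M), F (l % M) := by
    have h1 : ∑ l ∈ Finset.Icc 1 (K * M), F (l % M) = ∑ l ∈ range (K * M), F ((l + 1) % M) := by
      rw [range_eq_Ico, sum_Ico_add' (fun l => F (l % M)) 0 (K * M) 1]
      rfl
    have h2 := sum_range_succ (fun l => F (l % M)) (K * M)
    rw [sum_range_succ'] at h2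
    simp only [Nat.mul_mod_left, Nat.zero_mod] at h2
    linarith
  rw [hshift, sum_range_mul_eq_s7]
  have h : ∀ h ∈ range K, ∑ r ∈ range M, F ((h * M + r) % M) = ∑ r ∈ range M, F r := by
    intro h _
    refine sum_congr rfl fun r hr => ?_
    rw [Nat.mul_add_mod', Nat.mod_eq_of_lt (mem_range.1 hr)]
  rw [sum_congr rfl h]
  simp

theorem sum_range_succ_mod (m : ℕ) (F : ℕ → ℝ) :
    ∑ h ∈ range (m + 1), F ((h + 1) % (m + 1)) = ∑ h ∈ range (m + 1), F h := by
  rw [sum_range_succ, sum_range_succ' F]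
  congr 1
  · refine sum_congr rfl fun h hh => ?_
    rw [Nat.mod_eq_of_lt (by have := mem_range.1 hh; omega)]
  · simp

/-- Sum of a product of two functions of the block index, each block of length `q` being
shifted by complementary amounts `ν` and `μ`. -/
theorem sum_shifted_blocks (b q ν μ : ℕ) (hb : 2 ≤ b) (hq : ν + μ + 1 = q) (hle : ν ≤ μ)
    (f g : ℕ → ℝ) (hf : f 0 = 0) :
    ∑ l ∈ range (b * q), f ((l + μ) / q % b) * g ((l + ν) / q % b) =
      q * ∑ h ∈ range b, f h * g h + ((q : ℝ) - 1 - 2 * ν) *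
        (∑ h ∈ range (b - 1), f (h + 1) * g h - ∑ h ∈ range b, f h * g h) := by
  obtain ⟨d, rfl⟩ := Nat.exists_eq_add_of_le hle
  obtain ⟨m, rfl⟩ : ∃ m, b = m + 1 := ⟨b - 1, by omega⟩
  have hq' : q = (ν + 1) + d + ν := by omega
  have hdiv : ∀ h t : ℕ, t < q → (h * q + t) / q = h := fun h t ht => by
    rw [mul_comm, Nat.mul_add_div (by omega), Nat.div_eq_of_lt ht, add_zero]
  have hdiv' : ∀ h t : ℕ, q ≤ t → t < 2 * q → (h * q + t) / q = h + 1 := fun h t h1 h2 => by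
    obtain ⟨u, rfl⟩ := Nat.exists_eq_add_of_le h1
    rw [← hdiv (h + 1) u (by omega)]
    congr 1
    ring
  have hmod : ∀ h ∈ range (m + 1), h % (m + 1) = h := fun h hh =>
    Nat.mod_eq_of_lt (mem_range.1 hh)
  rw [sum_range_mul_eq_s7, sum_comm]
  have low : ∀ r ∈ range (ν + 1),
      ∑ h ∈ range (m + 1), f ((h * q + r + (ν + d)) / q % (m + 1)) *
        g ((h * q + r + ν) / q % (m + 1)) = ∑ h ∈ range (m + 1), f h * g h := by
    intro r hr
    have := mem_range.1 hr
    refine sum_congr rfl fun h hh => ?_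
    rw [add_assoc, add_assoc, hdiv _ _ (by omega), hdiv _ _ (by omega), hmod h hh]
  have mid : ∀ r ∈ range d,
      ∑ h ∈ range (m + 1), f ((h * q + (ν + 1 + r) + (ν + d)) / q % (m + 1)) *
        g ((h * q + (ν + 1 + r) + ν) / q % (m + 1)) = ∑ h ∈ range m, f (h + 1) * g h := by
    intro r hr
    have := mem_range.1 hr
    have key : ∀ h ∈ range (m + 1), f ((h * q + (ν + 1 + r) + (ν + d)) / q % (m + 1)) *
        g ((h * q + (ν + 1 + r) + ν) / q % (m + 1)) = f ((h + 1) % (m + 1)) * g h := by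
      intro h hh
      rw [add_assoc, add_assoc (h * q), hdiv' _ _ (by omega) (by omega), hdiv _ _ (by omega),
        hmod h hh]
    rw [sum_congr rfl key, sum_range_succ, Nat.mod_self, hf, zero_mul, add_zero]
    refine sum_congr rfl fun h hh => ?_
    rw [Nat.mod_eq_of_lt (by have := mem_range.1 hh; omega)]
  have high : ∀ r ∈ range ν,
      ∑ h ∈ range (m + 1), f ((h * q + (ν + 1 + d + r) + (ν + d)) / q % (m + 1)) *
        g ((h * q + (ν + 1 + d + r) + ν) / q % (m + 1)) = ∑ h ∈ range (m + 1), f h * g h := by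
    intro r hr
    have := mem_range.1 hr
    rw [← sum_range_succ_mod m fun h => f h * g h]
    refine sum_congr rfl fun h _ => ?_
    rw [add_assoc, add_assoc (h * q), hdiv' _ _ (by omega) (by omega),
      hdiv' _ _ (by omega) (by omega)]
  nth_rewrite 1 [hq']
  rw [sum_range_add, sum_range_add, sum_congr rfl low, sum_congr rfl mid, sum_congr rfl high]
  have hqr : (q : ℝ) = (ν + 1) + d + ν := by exact_mod_cast hq'
  simp only [sum_const, card_range, nsmul_eq_mul, hqr, Nat.add_sub_cancel]
  push_cast
  ring

theorem phi_zero_left {b : ℕ} (σ : Equiv.Perm (Fin b)) (x : ℝ) : phi σ 0 x = 0 := by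
  simp [phi]

theorem phi_of_fract_eq_zero {b : ℕ} (σ : Equiv.Perm (Fin b)) (h : ℕ) (x : ℝ)
    (hx : Int.fract x = 0) : phi σ h x = 0 := by
  unfold phi
  simp only [hx, mul_zero, Int.floor_zero, Int.toNat_zero, zero_add, range_one]
  split_ifs with hh
  · simp [filter_singleton, not_lt.2 hh]
  · simp [filter_singleton, hh]

theorem permVal_add_permVal_pbar {b : ℕ} (σ : Equiv.Perm (Fin b)) (k : ℕ) (hk : k < b) :
    permVal σ k + permVal (pbar σ) k = b - 1 := by
  have := (σ ⟨k, hk⟩).isLt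
  simp only [permVal, hk, dite_true, pbar, tauP, Equiv.trans_apply, Fin.revPerm_apply, Fin.val_rev]
  omega

theorem nu_add_nu_pbar (b : ℕ) (hb : 2 ≤ b) (n : ℕ) (S : Fin n → Equiv.Perm (Fin b))
    (N j : ℕ) (hj : j ≤ n) :
    nu b n S N j + nu b n (fun i => pbar (S i)) N j + 1 = b ^ (n - j) := by
  have hsum : nu b n S N j + nu b n (fun i => pbar (S i)) N j =
      ∑ i ∈ range n, if j ≤ i then (b - 1) * b ^ (n - 1 - i) else 0 := by
    rw [← Fin.sum_univ_eq_sum_range (fun i => if j ≤ i then (b - 1) * b ^ (n - 1 - i) else 0),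
      nu, nu, ← sum_add_distrib]
    refine sum_congr rfl fun i _ => ?_
    split_ifs
    · rw [← add_mul, permVal_add_permVal_pbar _ _ (Nat.mod_lt _ (by omega))]
    · rfl
  rw [hsum]
  obtain ⟨k, rfl⟩ := Nat.exists_eq_add_of_le hj
  have hlow : ∑ i ∈ range j, (if j ≤ i then (b - 1) * b ^ (j + k - 1 - i) else 0) = 0 :=
    sum_eq_zero fun i hi => if_neg (by have := mem_range.1 hi; omega)
  have hhigh : ∀ i ∈ range k, (if j ≤ j + i then (b - 1) * b ^ (j + k - 1 - (j + i)) else 0) =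
      (b - 1) * b ^ (k - 1 - i) := fun i _ => by
    rw [if_pos (by omega)]
    congr 2
    omega
  rw [sum_range_add, hlow, zero_add, sum_congr rfl hhigh,
    sum_range_reflect (fun i => (b - 1) * b ^ i) k, ← mul_sum, Nat.add_sub_cancel_left, mul_comm,
    Nat.geomSum_eq hb, Nat.div_mul_cancel (by simpa using Nat.sub_dvd_pow_sub_pow b 1 k)]
  have := Nat.pow_pos (n := k) (show 0 < b by omega)
  omega

/-- Closed form of `eps` for `j < n`, in terms of the complement `μ` of `ν_j`. -/
theorem eps_eq_div_mod (b n : ℕ) (S : Fin n → Equiv.Perm (Fin b))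
    (lam N j μ : ℕ) (hj : j < n) (hj1 : 1 ≤ j) (hN : N ≠ b ^ n)
    (hμ : nu b n S N j + μ + 1 = b ^ (n - j)) :
    eps b n S lam N j = (lam % b ^ (n - j + 1) + μ) / b ^ (n - j) % b := by
  unfold eps
  have hle : lam % b ^ (n - j + 1) ≤ nu b n S N j →
      (lam % b ^ (n - j + 1) + μ) / b ^ (n - j) % b = 0 := fun h => by
    rw [Nat.div_eq_of_lt (by omega), Nat.zero_mod]
  split_ifs with h1 h2 h3
  · have hl : lam = b ^ n := h1.resolve_right hN
    rw [hle]
    rw [hl, Nat.mod_eq_zero_of_dvd (pow_dvd_pow b (by omega))]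
    exact Nat.zero_le _
  · omega
  · rw [hle h3]
  · rw [← Nat.add_div_right _ (by omega)]
    congr 2
    omega

theorem eps_self (b n : ℕ) (hn : 1 ≤ n) (S : Fin n → Equiv.Perm (Fin b)) (lam N : ℕ)
    (hN : N ≠ b ^ n) : eps b n S lam N n = lam % b := by
  rw [eps, if_pos rfl]
  split_ifs with h
  · rw [h.resolve_right hN, Nat.mod_eq_zero_of_dvd (dvd_pow_self b (by omega))]
  · rfl

theorem phi_pow_div_pow {b : ℕ} (hb : 2 ≤ b) (σ : Equiv.Perm (Fin b)) (h n j : ℕ) (hj : j ≤ n) :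
    phi σ h (((b ^ n : ℕ) : ℝ) / (b : ℝ) ^ j) = 0 := by
  apply phi_of_fract_eq_zero
  have hb0 : (b : ℝ) ≠ 0 := by positivity
  have : ((b ^ n : ℕ) : ℝ) / (b : ℝ) ^ j = ((b ^ (n - j) : ℕ) : ℝ) := by
    push_cast
    rw [pow_sub₀ _ hb0 hj, div_eq_mul_inv]
  rw [this, Int.fract_natCast]

theorem sum_eps_eq (b : ℕ) (hb : 2 ≤ b) (n : ℕ) (S : Fin n → Equiv.Perm (Fin b))
    (N j : ℕ) (hj : j < n) (hj1 : 1 ≤ j) (hN : N ≠ b ^ n) (f g : ℕ → ℝ) :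
    ∑ lam ∈ Finset.Icc 1 (b ^ n),
        f (eps b n S lam N j) * g (eps b n (fun i => pbar (S i)) lam N j) =
      (b : ℝ) ^ (j - 1) * ∑ l ∈ range (b * b ^ (n - j)),
        f ((l + nu b n (fun i => pbar (S i)) N j) / b ^ (n - j) % b) *
          g ((l + nu b n S N j) / b ^ (n - j) % b) := by
  have hν := nu_add_nu_pbar b hb n S N j hj.le
  have hpow : b ^ n = b ^ (j - 1) * b ^ (n - j + 1) := by
    rw [← pow_add]
    congr 1
    omega
  have h := sum_Icc_mod (b ^ (j - 1)) (b ^ (n - j + 1)) fun l =>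
    f ((l + nu b n (fun i => pbar (S i)) N j) / b ^ (n - j) % b) *
      g ((l + nu b n S N j) / b ^ (n - j) % b)
  rw [← hpow, pow_succ', Nat.cast_pow] at h
  rw [← h]
  refine sum_congr rfl fun lam _ => ?_
  rw [eps_eq_div_mod b n S lam N j _ hj hj1 hN hν,
    eps_eq_div_mod b n _ lam N j (nu b n S N j) hj hj1 hN (by omega), pow_succ']

theorem stmt7 (b : ℕ) (hb : 2 ≤ b) (n : ℕ) (hn : 1 ≤ n) (σ : Equiv.Perm (Fin b))
    (S : Fin n → Equiv.Perm (Fin b))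
    (hS : ∀ i, S i = σ ∨ S i = pbar σ)
    (N : ℕ) (hN1 : 1 ≤ N) (hN2 : N ≤ b ^ n) :
    (∀ j : ℕ, 1 ≤ j → j ≤ n - 1 →
      (((nu b n S N j : ℝ) < ((b : ℝ) ^ (n - j) - 1) / 2 →
        ∑ lam ∈ Finset.Icc 1 (b ^ n),
            phi σ (eps b n S lam N j) ((N : ℝ) / (b : ℝ) ^ j) *
              phi (pbar σ) (eps b n (fun i => pbar (S i)) lam N j)
                ((N : ℝ) / (b : ℝ) ^ j) =
          (b : ℝ) ^ (n - 1) * phiT σ ((N : ℝ) / (b : ℝ) ^ j)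
            + (b : ℝ) ^ (j - 1) * ((b : ℝ) ^ (n - j) - 1 - 2 * (nu b n S N j : ℝ)) *
                (phiT1 σ ((N : ℝ) / (b : ℝ) ^ j) - phiT σ ((N : ℝ) / (b : ℝ) ^ j)))
        ∧ (((b : ℝ) ^ (n - j) - 1) / 2 ≤ (nu b n S N j : ℝ) →
          ∑ lam ∈ Finset.Icc 1 (b ^ n),
              phi σ (eps b n S lam N j) ((N : ℝ) / (b : ℝ) ^ j) *
                phi (pbar σ) (eps b n (fun i => pbar (S i)) lam N j)
                  ((N : ℝ) / (b : ℝ) ^ j) =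
            (b : ℝ) ^ (n - 1) * phiT σ ((N : ℝ) / (b : ℝ) ^ j)
              + (b : ℝ) ^ (j - 1) * (2 * (nu b n S N j : ℝ) + 1 - (b : ℝ) ^ (n - j)) *
                  (phiT2 σ ((N : ℝ) / (b : ℝ) ^ j) - phiT σ ((N : ℝ) / (b : ℝ) ^ j)))))
      ∧ (∑ lam ∈ Finset.Icc 1 (b ^ n),
            phi σ (eps b n S lam N n) ((N : ℝ) / (b : ℝ) ^ n) *
              phi (pbar σ) (eps b n (fun i => pbar (S i)) lam N n)
                ((N : ℝ) / (b : ℝ) ^ n) =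
          (b : ℝ) ^ (n - 1) * phiT σ ((N : ℝ) / (b : ℝ) ^ n)) := by
  by_cases hN : N = b ^ n
  · subst hN
    refine ⟨fun j _ hj => ?_, ?_⟩
    · have hz : ∀ (ρ : Equiv.Perm (Fin b)) h,
          phi ρ h (((b ^ n : ℕ) : ℝ) / (b : ℝ) ^ j) = 0 :=
        fun ρ h => phi_pow_div_pow hb ρ h n j (by omega)
      simp only [phiT, phiT1, phiT2, hz, mul_zero, sum_const_zero, sub_zero, add_zero, implies_true,
        and_self]
    · have hz : ∀ (ρ : Equiv.Perm (Fin b)) h,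
          phi ρ h (((b ^ n : ℕ) : ℝ) / (b : ℝ) ^ n) = 0 :=
        fun ρ h => phi_pow_div_pow hb ρ h n n le_rfl
      simp only [phiT, hz, mul_zero, sum_const_zero]
  refine ⟨fun j hj1 hj => ?_, ?_⟩
  · set x := (N : ℝ) / (b : ℝ) ^ j
    have hν := nu_add_nu_pbar b hb n S N j (by omega)
    have hνR : (nu b n S N j : ℝ) + nu b n (fun i => pbar (S i)) N j + 1 = (b : ℝ) ^ (n - j) := by
      exact_mod_cast hν
    have hpow : (b : ℝ) ^ (n - 1) = (b : ℝ) ^ (j - 1) * (b : ℝ) ^ (n - j) := by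
      rw [← pow_add]
      congr 1
      omega
    rw [sum_eps_eq b hb n S N j (by omega) hj1 hN (fun h => phi σ h x)
      (fun h => phi (pbar σ) h x), hpow]
    refine ⟨fun hlt => ?_, fun hge => ?_⟩
    · have hle : nu b n S N j ≤ nu b n (fun i => pbar (S i)) N j := by
        have : (nu b n S N j : ℝ) ≤ nu b n (fun i => pbar (S i)) N j := by linarith
        exact_mod_cast this
      rw [sum_shifted_blocks b (b ^ (n - j)) _ _ hb hν hle (fun h => phi σ h x)
        (fun h => phi (pbar σ) h x) (phi_zero_left σ x), phiT, phiT1]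
      push_cast
      ring
    · have hle : nu b n (fun i => pbar (S i)) N j ≤ nu b n S N j := by
        have : (nu b n (fun i => pbar (S i)) N j : ℝ) ≤ nu b n S N j := by linarith
        exact_mod_cast this
      have h := sum_shifted_blocks b (b ^ (n - j)) _ _ hb (by omega) hle
        (fun h => phi (pbar σ) h x) (fun h => phi σ h x) (phi_zero_left _ x)
      simp only [mul_comm (phi (pbar σ) _ x)] at h
      rw [h, phiT, phiT2]
      push_cast
      rw [← hνR]
      ring
  · have h := sum_Icc_mod (b ^ (n - 1)) b fun l =>
      phi σ l ((N : ℝ) / (b : ℝ) ^ n) * phi (pbar σ) l ((N : ℝ) / (b : ℝ) ^ n)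
    rw [← pow_succ, Nat.sub_add_cancel hn, Nat.cast_pow] at h
    simp only [eps_self b n hn _ _ N hN]
    exact h

end SymHamm
end
end

section
/- Let b ≥ 2, n ≥ 1 and j ∈ {1,…,n}, and let id be the identity permutation of {0,…,b−1}. Then ∑_{N=1}^{b^j} φ̃_b^{id}(N/b^j) = b^j·(∫_0^1 φ̃_b^{id}(x) dx + A_b(j,id)/2), ∑_{N=1}^{b^j} φ̃_{b,1}^{id}(N/b^j) = b^j·(∫_0^1 φ̃_{b,1}^{id}(x) dx + Ā_b(j,id)/2), and ∑_{N=1}^{b^j} φ̃_{b,2}^{id}(N/b^j) = b^j·(∫_0^1 φ̃_{b,2}^{id}(x) dx + Ā_b(j,id)/2), where A_b(j,id) = −(b^3+2b)/(36·b^{2j}) if b is even, A_b(j,id) = −(b^3−b)/(36·b^{2j}) if b is odd, Ā_b(j,id) = −(b^3−4b)/(36·b^{2j}) if b is even, and Ā_b(j,id) = −(b^3−b)/(36·b^{2j}) if b is odd. -/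
open Finset
open scoped Classical

noncomputable section

namespace SymHamm

/-- The tent function on `[0,1]` vanishing at `0` and `1`, with slope `b − p` up to `p/b`
and slope `−p` afterwards. -/
def tent (b p : ℕ) (x : ℝ) : ℝ := min ((p : ℝ) * (1 - x)) (((b : ℝ) - p) * x)

lemma continuous_tent (b p : ℕ) : Continuous (tent b p) := by
  unfold tent
  fun_prop

lemma tent_of_le {b p : ℕ} {x : ℝ} (h : (p : ℝ) ≤ b * x) : tent b p x = p * (1 - x) :=
  min_eq_left (by linarith)

lemma tent_of_ge {b p : ℕ} {x : ℝ} (h : b * x ≤ (p : ℝ)) : tent b p x = (b - p) * x :=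
  min_eq_right (by linarith)

lemma tent_zero {b p : ℕ} : tent b p 0 = 0 := by simp [tent]

lemma tent_one {b p : ℕ} (h : p ≤ b) : tent b p 1 = 0 := by
  have : (p : ℝ) ≤ b := by exact_mod_cast h
  simp [tent, this]

lemma le_toNat_floor_iff {y : ℝ} (hy : 0 ≤ y) (h : ℕ) : h ≤ ⌊y⌋.toNat ↔ (h : ℝ) ≤ y := by
  rw [Int.floor_toNat, Nat.le_floor_iff hy]

lemma toNat_floor_lt {b : ℕ} (hb : 0 < b) (x : ℝ) : ⌊(b : ℝ) * Int.fract x⌋.toNat < b := by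
  have hb' : (0 : ℝ) < b := by exact_mod_cast hb
  by_contra! h
  rw [le_toNat_floor_iff (mul_nonneg hb'.le (Int.fract_nonneg x))] at h
  nlinarith [Int.fract_lt_one x]

lemma phi_one_eq_tent_fract {b h : ℕ} (hb : 0 < b) (x : ℝ) :
    phi (1 : Equiv.Perm (Fin b)) h x = tent b h (Int.fract x) := by
  have hm := toNat_floor_lt hb x
  have hiff := le_toNat_floor_iff (mul_nonneg b.cast_nonneg (Int.fract_nonneg x)) (y := b * _) h
  unfold phi
  set m := ⌊(b : ℝ) * Int.fract x⌋.toNat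
  have hv : ∀ l, l ≤ m → permVal (1 : Equiv.Perm (Fin b)) l = l := fun l hl => by
    simp [permVal, show l < b by omega]
  rw [hv m le_rfl]
  split_ifs with hc
  · have : (range (m + 1)).filter (fun l => permVal (1 : Equiv.Perm (Fin b)) l < h) = range h := by
      ext l
      simp only [mem_filter, mem_range]
      constructor
      · rintro ⟨h1, h2⟩
        rwa [hv l (by omega)] at h2
      · intro h1
        refine ⟨by omega, ?_⟩
        rwa [hv l (by omega)]
    rw [this, card_range, tent_of_le (hiff.1 hc)]
    ring
  · have : (range (m + 1)).filter (fun l => h ≤ permVal (1 : Equiv.Perm (Fin b)) l) = ∅ := by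
      refine filter_eq_empty_iff.2 fun l hl => ?_
      rw [mem_range] at hl
      rw [hv l (by omega)]
      omega
    rw [this, tent_of_ge (not_le.1 (mt hiff.2 hc)).le]
    simp

lemma phi_pbar_one_eq_tent_fract {b h : ℕ} (hh : h < b) (x : ℝ) :
    phi (pbar (1 : Equiv.Perm (Fin b))) h x = -tent b (b - h) (Int.fract x) := by
  have hm := toNat_floor_lt (by omega : 0 < b) x
  have hiff := le_toNat_floor_iff (mul_nonneg b.cast_nonneg (Int.fract_nonneg x)) (y := b * _)
    (b - h)
  unfold phi
  set m := ⌊(b : ℝ) * Int.fract x⌋.toNat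
  have hv : ∀ l, l ≤ m → permVal (pbar (1 : Equiv.Perm (Fin b))) l = b - (l + 1) := fun l hl => by
    simp [permVal, pbar, tauP, show l < b by omega]
  have hcast : ((b - h : ℕ) : ℝ) = b - h := Nat.cast_sub hh.le
  rw [hv m le_rfl]
  split_ifs with hc
  · have : (range (m + 1)).filter (fun l => permVal (pbar (1 : Equiv.Perm (Fin b))) l < h) = ∅ := by
      refine filter_eq_empty_iff.2 fun l hl => ?_
      rw [mem_range] at hl
      rw [hv l (by omega)]
      omega
    rw [this, tent_of_ge (not_le.1 (mt hiff.2 (by omega))).le, hcast]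
    simp
  · have : (range (m + 1)).filter (fun l => h ≤ permVal (pbar (1 : Equiv.Perm (Fin b))) l)
        = range (b - h) := by
      ext l
      simp only [mem_filter, mem_range]
      constructor
      · rintro ⟨h1, h2⟩
        rw [hv l (by omega)] at h2
        omega
      · intro h1
        refine ⟨by omega, ?_⟩
        rw [hv l (by omega)]
        omega
    rw [this, card_range, tent_of_le (hiff.1 (by omega)), hcast]
    ring

lemma tent_fract {b p : ℕ} (hp : p ≤ b) {x : ℝ} (hx : x ∈ Set.Icc (0 : ℝ) 1) :
    tent b p (Int.fract x) = tent b p x := by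
  rcases hx.2.lt_or_eq with h | rfl
  · rw [Int.fract_eq_self.2 ⟨hx.1, h⟩]
  · rw [Int.fract_one, tent_zero, tent_one hp]

lemma phi_one_eq_tent {b h : ℕ} (hh : h < b) {x : ℝ} (hx : x ∈ Set.Icc (0 : ℝ) 1) :
    phi (1 : Equiv.Perm (Fin b)) h x = tent b h x := by
  rw [phi_one_eq_tent_fract (by omega), tent_fract hh.le hx]

lemma phi_pbar_one_eq_tent {b h : ℕ} (hh : h < b) {x : ℝ} (hx : x ∈ Set.Icc (0 : ℝ) 1) :
    phi (pbar (1 : Equiv.Perm (Fin b))) h x = -tent b (b - h) x := by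
  rw [phi_pbar_one_eq_tent_fract hh, tent_fract (Nat.sub_le b h) hx]

/-- The error of the trapezoidal rule on a product of two affine functions. -/
lemma integral_affine_mul_affine (a s c t u v : ℝ) :
    ∫ x in u..v, (a + s * x) * (c + t * x) =
      (v - u) * ((a + s * u) * (c + t * u) + (a + s * v) * (c + t * v)) / 2
        - (v - u) ^ 3 * (s * t) / 6 := by
  have h : ∀ x ∈ Set.uIcc u v, HasDerivAt
      (fun y : ℝ => a * c * y + (a * t + s * c) * y ^ 2 / 2 + s * t * y ^ 3 / 3)
      ((a + s * x) * (c + t * x)) x := fun x _ => by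
    have h1 := (hasDerivAt_id' x).const_mul (a * c)
    have h2 := ((hasDerivAt_pow 2 x).const_mul (a * t + s * c)).div_const 2
    have h3 := ((hasDerivAt_pow 3 x).const_mul (s * t)).div_const 3
    refine ((h1.add h2).add h3).congr_deriv ?_
    norm_num
    ring
  rw [intervalIntegral.integral_eq_sub_of_hasDerivAt h
    (Continuous.intervalIntegrable (by fun_prop) _ _)]
  ring

/-- The slope of `tent b p` on the `N`-th cell of the grid with mesh `1/(bK)`. -/
def tentSlope (b K p N : ℕ) : ℝ := (if N < p * K then (b : ℝ) else 0) - p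

lemma exists_tent_eq_affine {b K : ℕ} (hb : 0 < b) (hK : 0 < K) (p N : ℕ) :
    ∃ a : ℝ, ∀ x ∈ Set.Icc ((N : ℝ) / (b * K : ℕ)) ((N + 1 : ℕ) / (b * K : ℕ)),
      tent b p x = a + tentSlope b K p N * x := by
  have hb' : (0 : ℝ) < b := by exact_mod_cast hb
  have hK' : (0 : ℝ) < K := by exact_mod_cast hK
  have hM : (0 : ℝ) < (b * K : ℕ) := by exact_mod_cast Nat.mul_pos hb hK
  by_cases h : N < p * K
  · refine ⟨0, fun x hx => ?_⟩
    have h1 : ((N + 1 : ℕ) : ℝ) ≤ p * K := by exact_mod_cast h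
    have h2 := (le_div_iff₀ hM).1 hx.2
    push_cast at h1 h2
    rw [tent_of_ge (by nlinarith), tentSlope, if_pos h]
    ring
  · refine ⟨p, fun x hx => ?_⟩
    have h1 : (p : ℝ) * K ≤ N := by exact_mod_cast not_lt.1 h
    have h2 := (div_le_iff₀ hM).1 hx.1
    push_cast at h2
    rw [tent_of_le (by nlinarith), tentSlope, if_neg h]
    ring

lemma sum_tentSlope_mul {b : ℕ} (K : ℕ) {p q : ℕ} (hp : p ≤ b) (hq : q ≤ b) :
    ∑ N ∈ range (b * K), tentSlope b K p N * tentSlope b K q N =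
      b * K * (b * min (p : ℝ) q - p * q) := by
  have key : ∀ r ≤ b, ∑ N ∈ range (b * K), (if N < r * K then (1 : ℝ) else 0) = r * K := by
    intro r hr
    rw [sum_boole]
    have : (range (b * K)).filter (fun N => N < r * K) = range (r * K) := by
      ext N
      simp only [mem_filter, mem_range, and_iff_right_iff_imp]
      exact fun h => h.trans_le (Nat.mul_le_mul_right K hr)
    rw [this, card_range]
    push_cast
    ring
  have hterm : ∀ N, tentSlope b K p N * tentSlope b K q N =
      (b : ℝ) ^ 2 * (if N < min p q * K then 1 else 0) - b * q * (if N < p * K then 1 else 0)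
        - b * p * (if N < q * K then 1 else 0) + p * q := by
    intro N
    have : N < min p q * K ↔ N < p * K ∧ N < q * K := by
      rw [← Nat.mul_min_mul_right, lt_min_iff]
    simp only [tentSlope, this]
    by_cases h1 : N < p * K <;> by_cases h2 : N < q * K <;> simp [h1, h2] <;> ring
  simp_rw [hterm, sum_add_distrib, sum_sub_distrib, ← mul_sum]
  rw [key _ (min_le_of_left_le hp), key p hp, key q hq]
  simp
  ring

/-- The trapezoidal rule for a product of two tent functions. -/
lemma sum_tent_mul_tent {b K p q : ℕ} (hb : 0 < b) (hK : 0 < K) (hp : p ≤ b) (hq : q ≤ b) :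
    ∑ N ∈ Icc 1 (b * K), tent b p ((N : ℝ) / (b * K : ℕ)) * tent b q ((N : ℝ) / (b * K : ℕ)) =
      (b * K : ℕ) * (∫ x in (0 : ℝ)..1, tent b p x * tent b q x)
        + (b * min (p : ℝ) q - p * q) / (6 * (b * K : ℕ)) := by
  set M := b * K with hMdef
  have hM : (0 : ℝ) < M := by exact_mod_cast Nat.mul_pos hb hK
  set g : ℕ → ℝ := fun N => tent b p ((N : ℝ) / M) * tent b q ((N : ℝ) / M) with hg
  have hcell : ∀ N ∈ range M, ∫ x in ((N : ℝ) / M)..((N + 1 : ℕ) / M), tent b p x * tent b q x =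
      (g N + g (N + 1)) / (2 * M) - tentSlope b K p N * tentSlope b K q N / (6 * M ^ 3) := by
    intro N _
    obtain ⟨a, ha⟩ := exists_tent_eq_affine hb hK p N
    obtain ⟨c, hc⟩ := exists_tent_eq_affine hb hK q N
    rw [← hMdef] at ha hc
    have hle : (N : ℝ) / M ≤ (N + 1 : ℕ) / M := by
      gcongr
      omega
    rw [intervalIntegral.integral_congr
      (g := fun x => (a + tentSlope b K p N * x) * (c + tentSlope b K q N * x)),
      integral_affine_mul_affine]
    · simp only [hg]
      rw [ha _ (Set.left_mem_Icc.2 hle), ha _ (Set.right_mem_Icc.2 hle),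
        hc _ (Set.left_mem_Icc.2 hle), hc _ (Set.right_mem_Icc.2 hle)]
      have : ((N + 1 : ℕ) : ℝ) / M - N / M = 1 / M := by
        push_cast
        ring
      rw [this]
      field_simp
    · intro x hx
      rw [Set.uIcc_of_le hle] at hx
      simp only [ha x hx, hc x hx]
  have hint : ∫ x in (0 : ℝ)..1, tent b p x * tent b q x =
      ∑ N ∈ range M, ∫ x in ((N : ℝ) / M)..((N + 1 : ℕ) / M), tent b p x * tent b q x := by
    rw [intervalIntegral.sum_integral_adjacent_intervals (a := fun N : ℕ => (N : ℝ) / M)]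
    · simp [div_self hM.ne']
    · intro N _
      exact ((continuous_tent b p).mul (continuous_tent b q)).intervalIntegrable _ _
  have hg0 : g 0 = 0 := by simp [hg, tent_zero]
  have hgM : g M = 0 := by simp [hg, div_self hM.ne', tent_one hp]
  have hsucc : ∑ N ∈ range M, g (N + 1) = ∑ N ∈ Icc 1 M, g N := by
    rw [range_eq_Ico, sum_Ico_add' g 0 M 1]
    rfl
  have hself : ∑ N ∈ range M, g N = ∑ N ∈ Icc 1 M, g N := by
    have := sum_range_succ g M
    rw [sum_range_succ' g M, hg0, hgM] at this
    rw [← hsucc]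
    linarith
  rw [hint, sum_congr rfl hcell, sum_sub_distrib, ← sum_div, ← sum_div, sum_add_distrib, hsucc,
    hself, sum_tentSlope_mul K hp hq]
  have : (b : ℝ) * K = M := by simp [hMdef]
  rw [this]
  field_simp
  ring

lemma sum_eq_of_eq_neg_sum_tent {ι : Type*} {b j : ℕ} (hb : 0 < b) (hj : 1 ≤ j) (s : Finset ι)
    (p q : ι → ℕ) (hp : ∀ i ∈ s, p i ≤ b) (hq : ∀ i ∈ s, q i ≤ b) (F : ℝ → ℝ)
    (hF : ∀ x ∈ Set.Icc (0 : ℝ) 1, F x = -∑ i ∈ s, tent b (p i) x * tent b (q i) x) :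
    ∑ N ∈ Icc 1 (b ^ j), F ((N : ℝ) / (b : ℝ) ^ j) =
      (b : ℝ) ^ j * ((∫ x in (0 : ℝ)..1, F x)
        - (b * ∑ i ∈ s, min (p i : ℝ) (q i) - ∑ i ∈ s, (p i : ℝ) * q i) /
          (6 * (b : ℝ) ^ (2 * j))) := by
  have hb' : (0 : ℝ) < b := by exact_mod_cast hb
  have hint : ∫ x in (0 : ℝ)..1, F x =
      -∑ i ∈ s, ∫ x in (0 : ℝ)..1, tent b (p i) x * tent b (q i) x := by
    rw [intervalIntegral.integral_congr
      (g := fun x => -∑ i ∈ s, tent b (p i) x * tent b (q i) x),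
      intervalIntegral.integral_neg, intervalIntegral.integral_finsetSum]
    · exact fun i _ =>
        ((continuous_tent b (p i)).mul (continuous_tent b (q i))).intervalIntegrable _ _
    · intro x hx
      rw [Set.uIcc_of_le zero_le_one] at hx
      exact hF x hx
  have hsum : ∀ N ∈ Icc 1 (b ^ j), F ((N : ℝ) / (b : ℝ) ^ j) =
      -∑ i ∈ s, tent b (p i) ((N : ℝ) / (b : ℝ) ^ j) * tent b (q i) ((N : ℝ) / (b : ℝ) ^ j) := by
    intro N hN
    refine hF _ ⟨by positivity, div_le_one_of_le₀ ?_ (by positivity)⟩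
    exact_mod_cast (mem_Icc.1 hN).2
  have hpair : ∀ i ∈ s, ∑ N ∈ Icc 1 (b ^ j),
      tent b (p i) ((N : ℝ) / (b : ℝ) ^ j) * tent b (q i) ((N : ℝ) / (b : ℝ) ^ j) =
      (b : ℝ) ^ j * (∫ x in (0 : ℝ)..1, tent b (p i) x * tent b (q i) x)
        + (b * min (p i : ℝ) (q i) - p i * q i) / (6 * (b : ℝ) ^ j) := by
    intro i hi
    have hpow : b * b ^ (j - 1) = b ^ j := mul_pow_sub_one (by omega) b
    have := sum_tent_mul_tent hb (pow_pos hb (j - 1)) (hp i hi) (hq i hi)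
    rw [hpow] at this
    simpa only [Nat.cast_pow] using this
  rw [sum_congr rfl hsum, sum_neg_distrib, sum_comm, sum_congr rfl hpair, hint, sum_add_distrib,
    ← mul_sum, ← sum_div, sum_sub_distrib, ← mul_sum]
  field_simp
  ring

lemma sum_min_sub (c : ℕ) :
    ∑ h ∈ range (c + 1), min (h : ℝ) (c - h) = ((c : ℝ) ^ 2 - if Even c then 0 else 1) / 4 := by
  induction c using Nat.twoStepInduction with
  | zero => simp
  | one => simp [sum_range_succ]
  | more c ih _ =>
    have hshift : ∀ h : ℕ, min ((h + 1 : ℕ) : ℝ) ((c + 2 : ℕ) - (h + 1 : ℕ)) =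
        min (h : ℝ) (c - h) + 1 := fun h => by
      rw [← min_add_add_right]
      push_cast
      ring_nf
    rw [sum_range_succ, sum_range_succ', sum_congr rfl fun h _ => hshift h, sum_add_distrib, ih]
    have : Even (c + 2) ↔ Even c := by simp [Nat.even_add]
    have h2 : (0 : ℝ) ≤ (c : ℝ) + 2 := by positivity
    simp only [this, sum_const, card_range, nsmul_eq_mul]
    push_cast
    simp only [sub_self, min_eq_right h2, sub_zero, min_eq_left h2]
    ring

lemma sum_mul_sub (n : ℕ) (c : ℝ) :
    ∑ h ∈ range (n + 1), (h : ℝ) * (c - h) = n * (n + 1) * (3 * c - 2 * n - 1) / 6 := by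
  induction n with
  | zero => simp
  | succ n ih =>
    rw [sum_range_succ, ih]
    push_cast
    ring

theorem stmt8 (b : ℕ) (hb : 2 ≤ b) (n : ℕ) (hn : 1 ≤ n)
    (j : ℕ) (hj1 : 1 ≤ j) (hj2 : j ≤ n) :
    (∑ N ∈ Finset.Icc 1 (b ^ j), phiT (1 : Equiv.Perm (Fin b)) ((N : ℝ) / (b : ℝ) ^ j) =
        (b : ℝ) ^ j * ((∫ x in (0:ℝ)..1, phiT (1 : Equiv.Perm (Fin b)) x)
          + (if Even b then -((b : ℝ) ^ 3 + 2 * (b : ℝ)) / (36 * (b : ℝ) ^ (2 * j))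
              else -((b : ℝ) ^ 3 - (b : ℝ)) / (36 * (b : ℝ) ^ (2 * j))) / 2))
      ∧ (∑ N ∈ Finset.Icc 1 (b ^ j), phiT1 (1 : Equiv.Perm (Fin b)) ((N : ℝ) / (b : ℝ) ^ j) =
          (b : ℝ) ^ j * ((∫ x in (0:ℝ)..1, phiT1 (1 : Equiv.Perm (Fin b)) x)
            + (if Even b then -((b : ℝ) ^ 3 - 4 * (b : ℝ)) / (36 * (b : ℝ) ^ (2 * j))
                else -((b : ℝ) ^ 3 - (b : ℝ)) / (36 * (b : ℝ) ^ (2 * j))) / 2))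
      ∧ (∑ N ∈ Finset.Icc 1 (b ^ j), phiT2 (1 : Equiv.Perm (Fin b)) ((N : ℝ) / (b : ℝ) ^ j) =
          (b : ℝ) ^ j * ((∫ x in (0:ℝ)..1, phiT2 (1 : Equiv.Perm (Fin b)) x)
            + (if Even b then -((b : ℝ) ^ 3 - 4 * (b : ℝ)) / (36 * (b : ℝ) ^ (2 * j))
                else -((b : ℝ) ^ 3 - (b : ℝ)) / (36 * (b : ℝ) ^ (2 * j))) / 2)) := by
  have hb0 : 0 < b := by omega
  obtain ⟨c, rfl⟩ : ∃ c, b = c + 1 := ⟨b - 1, by omega⟩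
  refine ⟨?_, ?_, ?_⟩
  · rw [sum_eq_of_eq_neg_sum_tent hb0 hj1 (range (c + 1)) (fun h => h) (fun h => c + 1 - h)
      (fun h hh => (mem_range.1 hh).le) (fun h _ => Nat.sub_le _ _)]
    · have hcast : ∀ h ∈ range (c + 1), ((c + 1 - h : ℕ) : ℝ) = (c + 1 : ℕ) - h := fun h hh =>
        Nat.cast_sub (mem_range.1 hh).le
      have hmul : ∑ h ∈ range (c + 1), (h : ℝ) * (c + 1 - h : ℕ) = _ :=
        (sum_congr rfl fun h hh => by rw [hcast h hh]).trans (sum_mul_sub c (c + 1 : ℕ))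
      have hmin := sum_min_sub (c + 1)
      rw [sum_range_succ, sub_self, min_eq_right (Nat.cast_nonneg _), add_zero,
        ← sum_congr rfl fun (h : ℕ) hh => congrArg (min (h : ℝ)) (hcast h hh)] at hmin
      rw [hmul, hmin]
      congr 1
      split_ifs <;> push_cast <;> field_simp <;> ring
    · intro x hx
      rw [phiT, ← sum_neg_distrib]
      refine sum_congr rfl fun h hh => ?_
      rw [phi_one_eq_tent (mem_range.1 hh) hx, phi_pbar_one_eq_tent (mem_range.1 hh) hx, mul_neg]
  · rw [sum_eq_of_eq_neg_sum_tent hb0 hj1 (range c) (fun h => h + 1) (fun h => c + 1 - h)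
      (fun h hh => by have := mem_range.1 hh; omega) (fun h _ => Nat.sub_le _ _)]
    · have hcast : ∀ h ∈ range c, ((c + 1 - h : ℕ) : ℝ) = (c + 2 : ℕ) - (h + 1 : ℕ) :=
        fun h hh => by
          rw [Nat.cast_sub (by have := mem_range.1 hh; omega)]
          push_cast
          ring
      have hmin := sum_min_sub (c + 2)
      rw [sum_range_succ, sub_self, min_eq_right (Nat.cast_nonneg _), sum_range_succ,
        sum_range_succ', Nat.cast_zero, sub_zero, min_eq_left (Nat.cast_nonneg _),
        min_eq_right (by push_cast; linarith [c.cast_nonneg (α := ℝ)]),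
        ← sum_congr rfl fun (h : ℕ) hh => congrArg (min ((h + 1 : ℕ) : ℝ)) (hcast h hh)] at hmin
      have hmul := sum_mul_sub c (c + 2 : ℕ)
      rw [sum_range_succ', Nat.cast_zero, zero_mul, add_zero,
        ← sum_congr rfl fun (h : ℕ) hh => congrArg (((h + 1 : ℕ) : ℝ) * ·) (hcast h hh)] at hmul
      rw [hmul, eq_sub_of_add_eq (eq_sub_of_add_eq (eq_sub_of_add_eq hmin))]
      have hpar : Even (c + 2) ↔ ¬ Even (c + 1) := Nat.even_add_one
      congr 1
      by_cases h : Even (c + 1) <;> simp only [hpar, h, not_true, not_false_iff, if_true, if_false]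
        <;> push_cast <;> field_simp <;> ring
    · intro x hx
      rw [phiT1, ← sum_neg_distrib]
      refine sum_congr rfl fun h hh => ?_
      have hlt : h < c := mem_range.1 hh
      rw [phi_one_eq_tent (by omega) hx, phi_pbar_one_eq_tent (by omega) hx, mul_neg]
  · rw [sum_eq_of_eq_neg_sum_tent hb0 hj1 (range c) (fun h => h) (fun h => c + 1 - (h + 1))
      (fun h hh => by have := mem_range.1 hh; omega) (fun h _ => Nat.sub_le _ _)]
    · have hcast : ∀ h ∈ range c, ((c + 1 - (h + 1) : ℕ) : ℝ) = c - h := fun h hh => by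
        rw [Nat.add_sub_add_right, Nat.cast_sub (mem_range.1 hh).le]
      have hmin := sum_min_sub c
      rw [sum_range_succ, sub_self, min_eq_right (Nat.cast_nonneg _), add_zero,
        ← sum_congr rfl fun (h : ℕ) hh => congrArg (min (h : ℝ)) (hcast h hh)] at hmin
      have hmul := sum_mul_sub c c
      rw [sum_range_succ, sub_self, mul_zero, add_zero,
        ← sum_congr rfl fun (h : ℕ) hh => congrArg ((h : ℝ) * ·) (hcast h hh)] at hmul
      rw [hmul, hmin]
      have hpar : Even (c + 1) ↔ ¬ Even c := Nat.even_add_one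
      congr 1
      by_cases h : Even c <;> simp only [hpar, h, not_true, not_false_iff, if_true, if_false]
        <;> push_cast <;> field_simp <;> ring
    · intro x hx
      rw [phiT2, ← sum_neg_distrib]
      refine sum_congr rfl fun h hh => ?_
      have hlt : h < c := mem_range.1 hh
      rw [phi_one_eq_tent (by omega) hx, phi_pbar_one_eq_tent (by omega) hx, mul_neg]

end SymHamm
end
end
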